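/- Let n = 2 and let 𝔸 be a first-order (k=1) homogeneous linear constant-coefficient differential operator on ℝ² from V to W with dim V ≥ 2. Suppose 𝔸 is elliptic but not ℂ-elliptic. Then 𝔸 is not cancelling, i.e. ⋂_{ζ ∈ ℝ²\{0}} 𝔸[ζ](V) ≠ {0}. -/

import Mathlib

noncomputable section

open MeasureTheory Metric
open scoped ENNReal RealInnerProductSpace

/-- Euclidean space `ℝⁿ`. -/
abbrev Euc (n : ℕ) : Type := EuclideanSpace ℝ (Fin n)

/-- The coefficient datum of a homogeneous `k`-th order linear constant-coefficient
differential operator `𝔸` from `V` to `W` on `ℝⁿ`: a linear map acting on the space of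
(values of) `k`-th derivatives, so that `𝔸 u (x) = A (D^k u (x))`. -/
abbrev OpCoeff (n k : ℕ) (V W : Type*) [NormedAddCommGroup V] [NormedSpace ℝ V]
    [NormedAddCommGroup W] [NormedSpace ℝ W] : Type _ :=
  ContinuousMultilinearMap ℝ (fun _ : Fin k => Euc n) V →L[ℝ] W

variable {n k : ℕ} {V W : Type*}
  [NormedAddCommGroup V] [InnerProductSpace ℝ V] [FiniteDimensional ℝ V]
  [NormedAddCommGroup W] [InnerProductSpace ℝ W] [FiniteDimensional ℝ W]

/-- `𝔸 u`, the operator applied to `u : ℝⁿ → V`. -/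
def opApply (A : OpCoeff n k V W) (u : Euc n → V) (x : Euc n) : W :=
  A (iteratedFDeriv ℝ k u x)

/-- The symmetric tensor `v ⊗^k ξ`, i.e. the `k`-linear map `(e₁,…,e_k) ↦ (∏ᵢ ⟪ξ,eᵢ⟫) • v`. -/
def symTensor (n k : ℕ) {V : Type*} [NormedAddCommGroup V] [NormedSpace ℝ V]
    (ξ : Euc n) (v : V) : ContinuousMultilinearMap ℝ (fun _ : Fin k => Euc n) V :=
  (ContinuousMultilinearMap.mkPiRing ℝ (Fin k) v).compContinuousLinearMap
    (fun _ => innerSL ℝ ξ)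

/-- The (real) symbol `𝔸[ξ] v = A (v ⊗^k ξ)`. -/
def symbol (A : OpCoeff n k V W) (ξ : Euc n) (v : V) : W :=
  A (symTensor n k ξ v)

/-- Ellipticity: `𝔸[ξ]` is injective for every real `ξ ≠ 0`. -/
def IsElliptic (A : OpCoeff n k V W) : Prop :=
  ∀ ξ : Euc n, ξ ≠ 0 → Function.Injective (symbol A ξ)

/-- Cancellation: `⋂_{ξ ≠ 0} 𝔸[ξ](V) = {0}`. -/
def IsCancelling (A : OpCoeff n k V W) : Prop :=
  (⋂ ξ ∈ {ξ : Euc n | ξ ≠ 0}, Set.range (symbol A ξ)) = {0}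

/-- The scalar `ℝ`-multilinear map `(e₁,…,e_k) ↦ ∏ᵢ (⟪η₁,eᵢ⟫ + i ⟪η₂,eᵢ⟫) ∈ ℂ`,
the building block for the complexified symbol at `ξ = η₁ + i η₂`. -/
def cxKernel (n k : ℕ) (η₁ η₂ : Euc n) :
    ContinuousMultilinearMap ℝ (fun _ : Fin k => Euc n) ℂ :=
  ((ContinuousMultilinearMap.mkPiRing ℂ (Fin k) (1 : ℂ)).restrictScalars ℝ).compContinuousLinearMap
    (fun _ => Complex.ofRealCLM.comp (innerSL ℝ η₁) + Complex.I • Complex.ofRealCLM.comp (innerSL ℝ η₂))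

/-- Real part of the complexified tensor `(v₁ + i v₂) ⊗^k (η₁ + i η₂)`. -/
def cxSymTensorRe (n k : ℕ) {V : Type*} [NormedAddCommGroup V] [NormedSpace ℝ V]
    (η₁ η₂ : Euc n) (v₁ v₂ : V) : ContinuousMultilinearMap ℝ (fun _ : Fin k => Euc n) V :=
  (Complex.reCLM.compContinuousMultilinearMap (cxKernel n k η₁ η₂)).smulRight v₁
    - (Complex.imCLM.compContinuousMultilinearMap (cxKernel n k η₁ η₂)).smulRight v₂

/-- Imaginary part of the complexified tensor `(v₁ + i v₂) ⊗^k (η₁ + i η₂)`. -/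
def cxSymTensorIm (n k : ℕ) {V : Type*} [NormedAddCommGroup V] [NormedSpace ℝ V]
    (η₁ η₂ : Euc n) (v₁ v₂ : V) : ContinuousMultilinearMap ℝ (fun _ : Fin k => Euc n) V :=
  (Complex.imCLM.compContinuousMultilinearMap (cxKernel n k η₁ η₂)).smulRight v₁
    + (Complex.reCLM.compContinuousMultilinearMap (cxKernel n k η₁ η₂)).smulRight v₂

/-- ℂ-ellipticity: the complexified symbol `𝔸[η₁ + i η₂]` is injective on `V + iV` for
every nonzero complex frequency `η₁ + i η₂`. -/
def IsCElliptic (A : OpCoeff n k V W) : Prop :=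
  ∀ η₁ η₂ : Euc n, ∀ v₁ v₂ : V, (η₁, η₂) ≠ 0 →
    A (cxSymTensorRe n k η₁ η₂ v₁ v₂) = 0 → A (cxSymTensorIm n k η₁ η₂ v₁ v₂) = 0 →
      v₁ = 0 ∧ v₂ = 0

/-- The null-space of `𝔸`: smooth maps `u : ℝⁿ → V` with `𝔸 u = 0`. -/
def nullSpace (A : OpCoeff n k V W) : Set (Euc n → V) :=
  {u | ContDiff ℝ (⊤ : ℕ∞) u ∧ ∀ x, opApply A u x = 0}

theorem symTensor_one_apply (ξ : Euc 2) (v : V) (e : Fin 1 → Euc 2) :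
    symTensor 2 1 ξ v e = (inner ℝ ξ (e 0) : ℝ) • v := by
  simp [symTensor]

theorem symbol_add_left (A : OpCoeff 2 1 V W) (ξ η : Euc 2) (v : V) :
    symbol A (ξ + η) v = symbol A ξ v + symbol A η v := by
  unfold symbol
  rw [← map_add]
  congr 1
  ext e
  simp only [symTensor_one_apply, ContinuousMultilinearMap.add_apply, inner_add_left, add_smul]

theorem symbol_smul_left (A : OpCoeff 2 1 V W) (a : ℝ) (ξ : Euc 2) (v : V) :
    symbol A (a • ξ) v = a • symbol A ξ v := by
  unfold symbol
  rw [← map_smul]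
  congr 1
  ext e
  simp only [symTensor_one_apply, ContinuousMultilinearMap.smul_apply, real_inner_smul_left,
    mul_smul]

theorem symbol_add_right (A : OpCoeff 2 1 V W) (ξ : Euc 2) (v w : V) :
    symbol A ξ (v + w) = symbol A ξ v + symbol A ξ w := by
  unfold symbol
  rw [← map_add]
  congr 1
  ext e
  simp only [symTensor_one_apply, ContinuousMultilinearMap.add_apply, smul_add]

theorem symbol_smul_right (A : OpCoeff 2 1 V W) (a : ℝ) (ξ : Euc 2) (v : V) :
    symbol A ξ (a • v) = a • symbol A ξ v := by
  unfold symbol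
  rw [← map_smul]
  congr 1
  ext e
  simp only [symTensor_one_apply, ContinuousMultilinearMap.smul_apply, smul_comm a]

theorem cxRe_eq (A : OpCoeff 2 1 V W) (η₁ η₂ : Euc 2) (v₁ v₂ : V) :
    A (cxSymTensorRe 2 1 η₁ η₂ v₁ v₂) = symbol A η₁ v₁ - symbol A η₂ v₂ := by
  unfold symbol
  rw [← map_sub]
  congr 1
  ext e
  simp [symTensor_one_apply, cxSymTensorRe, cxKernel]

theorem cxIm_eq (A : OpCoeff 2 1 V W) (η₁ η₂ : Euc 2) (v₁ v₂ : V) :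
    A (cxSymTensorIm 2 1 η₁ η₂ v₁ v₂) = symbol A η₂ v₁ + symbol A η₁ v₂ := by
  unfold symbol
  rw [← map_add]
  congr 1
  ext e
  simp [symTensor_one_apply, cxSymTensorIm, cxKernel]

/-- (`n = 2`, `k = 1`, `dim V ≥ 2`.) If a first-order operator on `ℝ²`
with `dim V ≥ 2` is elliptic but not ℂ-elliptic, then it is not cancelling. -/
theorem statement10 (A : OpCoeff 2 1 V W) (hV : 2 ≤ Module.finrank ℝ V)
    (hE : IsElliptic A) (hNC : ¬ IsCElliptic A) :
    ¬ IsCancelling A := by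
  have key : ∀ ξ : Euc 2, ξ ≠ 0 → ∀ v : V, symbol A ξ v = 0 → v = 0 := by
    intro ξ hξ v hv
    apply hE ξ hξ
    rw [hv]
    have := symbol_smul_right A 0 ξ (0 : V)
    simpa using this.symm
  have zl : ∀ v : V, symbol A 0 v = 0 := by
    intro v
    simpa using symbol_smul_left A 0 0 v
  have zr : ∀ ξ : Euc 2, symbol A ξ (0 : V) = 0 := by
    intro ξ
    simpa using symbol_smul_right A 0 ξ (0 : V)
  intro hC
  apply hNC
  intro η₁ η₂ v₁ v₂ hη hRe hIm
  rw [cxRe_eq, sub_eq_zero] at hRe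
  rw [cxIm_eq, add_comm, add_eq_zero_iff_eq_neg] at hIm
  -- `hRe : B η₁ v₁ = B η₂ v₂`, `hIm : B η₁ v₂ = - B η₂ v₁`
  by_cases hw : symbol A η₁ v₁ = 0
  · rcases eq_or_ne η₁ 0 with h1 | h1
    · have h2 : η₂ ≠ 0 := by
        rintro rfl
        exact hη (by rw [h1]; rfl)
      have hv2 := key η₂ h2 v₂ (by rw [← hRe, hw])
      refine ⟨key η₂ h2 v₁ ?_, hv2⟩
      rw [h1, zl] at hIm
      exact neg_eq_zero.mp hIm.symm
    · have hv1 := key η₁ h1 v₁ hw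
      refine ⟨hv1, key η₁ h1 v₂ ?_⟩
      rw [hIm, hv1, zr, neg_zero]
  · exfalso
    have hli : LinearIndependent ℝ ![η₁, η₂] := by
      rw [LinearIndependent.pair_iff]
      intro x y hxy
      have e1 : x • symbol A η₁ v₁ + y • symbol A η₂ v₁ = 0 := by
        rw [← symbol_smul_left, ← symbol_smul_left, ← symbol_add_left, hxy, zl]
      have e2 : x • symbol A η₁ v₂ + y • symbol A η₂ v₂ = 0 := by
        rw [← symbol_smul_left, ← symbol_smul_left, ← symbol_add_left, hxy, zl]
      rw [hIm, ← hRe] at e2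
      have e3 : (x * x + y * y) • symbol A η₁ v₁ = 0 := by
        have : (x * x + y * y) • symbol A η₁ v₁
            = x • (x • symbol A η₁ v₁ + y • symbol A η₂ v₁)
              + y • (x • (-symbol A η₂ v₁) + y • symbol A η₁ v₁) := by module
        rw [this, e1, e2]
        simp
      have e4 := (smul_eq_zero.mp e3).resolve_right hw
      constructor <;> nlinarith [mul_self_nonneg x, mul_self_nonneg y]
    have hspan := hli.span_eq_top_of_card_eq_finrank (by simp)
    apply hw
    have hmem : symbol A η₁ v₁ ∈ (⋂ ξ ∈ {ξ : Euc 2 | ξ ≠ 0}, Set.range (symbol A ξ)) := by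
      simp only [Set.mem_iInter]
      intro ξ hξ
      have hξs : ξ ∈ Submodule.span ℝ (Set.range ![η₁, η₂]) := by
        rw [hspan]; trivial
      rw [Matrix.range_cons, Matrix.range_cons, Matrix.range_empty, Set.union_empty,
        Set.singleton_union, Submodule.mem_span_pair] at hξs
      obtain ⟨a, b, rfl⟩ := hξs
      have hab : a * a + b * b ≠ 0 := by
        intro h
        have ha : a = 0 := by nlinarith [mul_self_nonneg a, mul_self_nonneg b]
        have hb : b = 0 := by nlinarith [mul_self_nonneg a, mul_self_nonneg b]
        apply hξ
        simp [ha, hb]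
      refine ⟨(a * a + b * b)⁻¹ • (a • v₁ + b • v₂), ?_⟩
      rw [symbol_smul_right, inv_smul_eq_iff₀ hab]
      simp only [symbol_add_left, symbol_add_right, symbol_smul_left, symbol_smul_right]
      rw [hIm, ← hRe]
      module
    rw [hC] at hmem
    exact hmem
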